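/- Let S_1,…,S_N be a representation of the Cuntz algebra 𝒪_N on ℋ, and let Q_π be the unique projection-valued measure on (Ω_N, 𝒞) with Q_π(E_f) = S_f S_f* for all finite words f. Then: (1) ∑_{i=1}^N S_i Q_π(E) S_i* = Q_π(σ^{-1}(E)) for every E ∈ 𝒞; (2) S_i Q_π(E) = Q_π(iE) S_i for every i ∈ {1,…,N} and every E ∈ 𝒞, where iE = {iω : ω ∈ E}; and (3) for every j ∈ {1,…,N} and every E ∈ 𝒞 with E ⊆ E_{(j)}, one has S_i* Q_π(E) = δ_{ij} Q_π(σ(E)) S_i* for all i ∈ {1,…,N}. -/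

import Mathlib

open ContinuousLinearMap Filter Topology

/-- `S_f = S_{i₁} S_{i₂} ⋯ S_{i_k}` for a finite word `f = (i₁,…,i_k)`. -/
noncomputable def SWord {H : Type*} [NormedAddCommGroup H] [InnerProductSpace ℂ H]
    {N : ℕ} (S : Fin N → H →L[ℂ] H) (f : List (Fin N)) : H →L[ℂ] H :=
  (f.map S).prod

/-- The cylinder set `E_f = {ω : ω_j = f_j for j < |f|}` of a finite word `f`. -/
def cylinder {N : ℕ} (f : List (Fin N)) : Set (ℕ → Fin N) :=
  {ω | ∀ j : Fin f.length, ω j = f.get j}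

/-- The σ-algebra `𝒞` on `Ω_N` generated by cylinder sets of nonempty finite words. -/
def cylinderSigma (N : ℕ) : MeasurableSpace (ℕ → Fin N) :=
  MeasurableSpace.generateFrom {E | ∃ f : List (Fin N), f ≠ [] ∧ E = cylinder f}

/-- A projection-valued measure on `(Ω_N, 𝒞)`: projection values on measurable sets,
`Q(∅) = 0`, `Q(Ω_N) = I`, and countable additivity in the strong operator topology. -/
def IsProjValuedMeasure {H : Type*} [NormedAddCommGroup H] [InnerProductSpace ℂ H]
    [CompleteSpace H] {N : ℕ} (Q : Set (ℕ → Fin N) → H →L[ℂ] H) : Prop :=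
  (∀ E, @MeasurableSet _ (cylinderSigma N) E → IsSelfAdjoint (Q E) ∧ Q E * Q E = Q E) ∧
  Q ∅ = 0 ∧ Q Set.univ = 1 ∧
  ∀ E : ℕ → Set (ℕ → Fin N), (∀ n, @MeasurableSet _ (cylinderSigma N) (E n)) →
    Pairwise (Function.onFun Disjoint E) →
    ∀ h : H, HasSum (fun n => Q (E n) h) (Q (⋃ n, E n) h)

/-- The one-sided shift `σ(ω) = (ω₂, ω₃, …)`. -/
def shiftWord {N : ℕ} (ω : ℕ → Fin N) : ℕ → Fin N := fun n => ω (n + 1)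

/-- `aω = (a, ω₁, ω₂, …)`. -/
def prependWord {N : ℕ} (a : Fin N) (ω : ℕ → Fin N) : ℕ → Fin N :=
  fun n => Nat.casesOn n a fun m => ω m

theorem mem_cylinder_cons {N : ℕ} (a : Fin N) (f : List (Fin N)) (ω : ℕ → Fin N) :
    ω ∈ cylinder (a :: f) ↔ ω 0 = a ∧ shiftWord ω ∈ cylinder f := by
  constructor
  · intro h
    refine ⟨h ⟨0, by simp⟩, fun j => ?_⟩
    exact h ⟨j.1 + 1, by simp⟩
  · rintro ⟨h0, h1⟩ ⟨j, hj⟩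
    cases j with
    | zero => exact h0
    | succ j => exact h1 ⟨j, by simpa using hj⟩

theorem cylinder_nil {N : ℕ} : cylinder ([] : List (Fin N)) = Set.univ := by
  ext ω
  simp only [Set.mem_univ, iff_true]
  intro j
  exact j.elim0

theorem shift_prepend {N : ℕ} (a : Fin N) (ω : ℕ → Fin N) :
    shiftWord (prependWord a ω) = ω := rfl

theorem prepend_shift {N : ℕ} (ω : ℕ → Fin N) :
    prependWord (ω 0) (shiftWord ω) = ω := by
  funext n
  cases n <;> rfl

theorem prepend_image {N : ℕ} (a : Fin N) (E : Set (ℕ → Fin N)) :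
    prependWord a '' E = {ω | ω 0 = a ∧ shiftWord ω ∈ E} := by
  ext ω
  constructor
  · rintro ⟨η, h, rfl⟩
    exact ⟨rfl, h⟩
  · rintro ⟨rfl, h⟩
    exact ⟨_, h, prepend_shift ω⟩

theorem prepend_cylinder {N : ℕ} (a : Fin N) (f : List (Fin N)) :
    prependWord a '' cylinder f = cylinder (a :: f) := by
  rw [prepend_image]
  ext ω
  exact (mem_cylinder_cons a f ω).symm

theorem meas_cylinder {N : ℕ} (f : List (Fin N)) :
    @MeasurableSet _ (cylinderSigma N) (cylinder f) := by
  by_cases h : f = []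
  · subst h
    rw [cylinder_nil]
    exact @MeasurableSet.univ _ (cylinderSigma N)
  · exact MeasurableSpace.measurableSet_generateFrom ⟨f, h, rfl⟩

theorem meas_shift {N : ℕ} :
    @Measurable _ _ (cylinderSigma N) (cylinderSigma N) (shiftWord (N := N)) := by
  refine @measurable_generateFrom _ _ (cylinderSigma N) _ _ ?_
  rintro _ ⟨f, -, rfl⟩
  have : shiftWord ⁻¹' cylinder f = ⋃ i : Fin N, cylinder (i :: f) := by
    ext ω
    simp [mem_cylinder_cons]
  rw [this]
  exact @MeasurableSet.iUnion _ _ (cylinderSigma N) _ _ (fun i => meas_cylinder _)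

theorem meas_prepend {N : ℕ} (a : Fin N) :
    @Measurable _ _ (cylinderSigma N) (cylinderSigma N) (prependWord a) := by
  refine @measurable_generateFrom _ _ (cylinderSigma N) _ _ ?_
  rintro _ ⟨f, hf, rfl⟩
  cases f with
  | nil => exact absurd rfl hf
  | cons b f =>
    by_cases h : a = b
    · have : prependWord a ⁻¹' cylinder (b :: f) = cylinder f := by
        ext ω
        rw [Set.mem_preimage, mem_cylinder_cons, shift_prepend]
        exact ⟨fun h => h.2, fun h' => ⟨h, h'⟩⟩
      rw [this]
      exact meas_cylinder f
    · have : prependWord a ⁻¹' cylinder (b :: f) = ∅ := by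
        ext ω
        rw [Set.mem_preimage, mem_cylinder_cons]
        exact ⟨fun h' => h h'.1, fun h' => h'.elim⟩
      rw [this]
      exact @MeasurableSet.empty _ (cylinderSigma N)

theorem meas_prepend_image {N : ℕ} (a : Fin N) (E : Set (ℕ → Fin N))
    (hE : @MeasurableSet _ (cylinderSigma N) E) :
    @MeasurableSet _ (cylinderSigma N) (prependWord a '' E) := by
  have : prependWord a '' E = cylinder [a] ∩ shiftWord ⁻¹' E := by
    rw [prepend_image]
    ext ω
    simp [mem_cylinder_cons, cylinder_nil]
  rw [this]
  exact @MeasurableSet.inter _ (cylinderSigma N) _ _ (meas_cylinder _) (meas_shift hE)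

theorem cylinder_inter {N : ℕ} (f : List (Fin N)) : ∀ g : List (Fin N),
    (cylinder f ∩ cylinder g).Nonempty →
    cylinder f ∩ cylinder g = cylinder f ∨ cylinder f ∩ cylinder g = cylinder g := by
  induction f with
  | nil => intro g _; right; simp [cylinder_nil]
  | cons a f ih =>
    intro g hg
    cases g with
    | nil => left; simp [cylinder_nil]
    | cons b g =>
      obtain ⟨ω, h1, h2⟩ := hg
      rw [mem_cylinder_cons] at h1 h2
      obtain rfl : a = b := h1.1.symm.trans h2.1
      have e : cylinder (a :: f) ∩ cylinder (a :: g)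
          = prependWord a '' (cylinder f ∩ cylinder g) := by
        rw [prepend_image]
        ext η
        simp only [Set.mem_inter_iff, mem_cylinder_cons, Set.mem_setOf_eq]
        tauto
      rw [e]
      rcases ih g ⟨_, h1.2, h2.2⟩ with h | h
      · left; rw [h, prepend_cylinder]
      · right; rw [h, prepend_cylinder]

theorem cylinder_piSystem (N : ℕ) :
    IsPiSystem {E | ∃ f : List (Fin N), f ≠ [] ∧ E = cylinder f} := by
  rintro _ ⟨f, hf, rfl⟩ _ ⟨g, hg, rfl⟩ hne
  rcases cylinder_inter f g hne with h | h
  · exact ⟨f, hf, h⟩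
  · exact ⟨g, hg, h⟩

section PVM

variable {H : Type*} [NormedAddCommGroup H] [InnerProductSpace ℂ H] [CompleteSpace H] {N : ℕ}

theorem pvm_union {Q : Set (ℕ → Fin N) → H →L[ℂ] H} (hQ : IsProjValuedMeasure Q)
    {E F : Set (ℕ → Fin N)} (hE : @MeasurableSet _ (cylinderSigma N) E)
    (hF : @MeasurableSet _ (cylinderSigma N) F) (hd : Disjoint E F) :
    Q (E ∪ F) = Q E + Q F := by
  obtain ⟨-, h0, -, hadd⟩ := hQ
  let G : ℕ → Set (ℕ → Fin N) := fun n => if n = 0 then E else if n = 1 then F else ∅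
  have hU : ⋃ n, G n = E ∪ F := by
    ext ω
    simp only [Set.mem_iUnion, Set.mem_union]
    constructor
    · rintro ⟨n, hn⟩
      simp only [G] at hn
      split_ifs at hn
      · exact Or.inl hn
      · exact Or.inr hn
      · exact hn.elim
    · rintro (h | h)
      · exact ⟨0, by simpa [G] using h⟩
      · exact ⟨1, by simpa [G] using h⟩
  have hm : ∀ n, @MeasurableSet _ (cylinderSigma N) (G n) := by
    intro n
    simp only [G]
    split_ifs
    · exact hE
    · exact hF
    · exact @MeasurableSet.empty _ (cylinderSigma N)
  have hp : Pairwise (Function.onFun Disjoint G) := by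
    intro m n hmn
    simp only [Function.onFun, G]
    split_ifs <;> first | omega | simp [hd, hd.symm]
  ext h
  have h1 := hadd G hm hp h
  rw [hU] at h1
  have h2 : HasSum (fun n => Q (G n) h) (∑ n ∈ Finset.range 2, Q (G n) h) := by
    apply hasSum_sum_of_ne_finset_zero
    intro n hn
    have hn : 2 ≤ n := by rw [Finset.mem_range] at hn; omega
    have : G n = ∅ := by
      simp only [G]
      rw [if_neg (by omega), if_neg (by omega)]
    rw [this, h0]
    rfl
  have h3 := h1.unique h2
  simpa [Finset.sum_range_succ, G] using h3

theorem pvm_finset {Q : Set (ℕ → Fin N) → H →L[ℂ] H} (hQ : IsProjValuedMeasure Q)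
    {ι : Type*} [DecidableEq ι] (s : Finset ι) (E : ι → Set (ℕ → Fin N))
    (hE : ∀ i, @MeasurableSet _ (cylinderSigma N) (E i))
    (hd : Pairwise (Function.onFun Disjoint E)) :
    Q (⋃ i ∈ s, E i) = ∑ i ∈ s, Q (E i) := by
  induction s using Finset.induction_on with
  | empty => simpa using hQ.2.1
  | insert a s ha ih =>
    rw [Finset.set_biUnion_insert, Finset.sum_insert ha, ← ih]
    refine pvm_union hQ (hE a) ?_ ?_
    · exact @Finset.measurableSet_biUnion _ _ (cylinderSigma N) _ s (fun i _ => hE i)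
    · simp only [Set.disjoint_iUnion_right]
      intro i hi
      exact hd (fun h => ha (h ▸ hi))

theorem pvm_prepend {S : Fin N → H →L[ℂ] H}
    {Q : Set (ℕ → Fin N) → H →L[ℂ] H}
    (hQ : IsProjValuedMeasure Q)
    (hQcyl : ∀ f : List (Fin N), f ≠ [] → Q (cylinder f) = SWord S f * adjoint (SWord S f))
    (i : Fin N) (E : Set (ℕ → Fin N)) (hE : @MeasurableSet _ (cylinderSigma N) E) :
    Q (prependWord i '' E) = S i * Q E * adjoint (S i) := by
  have hinj : Function.Injective (prependWord i) :=
    fun a b h => by simpa [shift_prepend] using congrArg shiftWord h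
  have huniv : Q (prependWord i '' Set.univ) = S i * adjoint (S i) := by
    rw [← cylinder_nil, prepend_cylinder, hQcyl _ (by simp)]
    simp [SWord]
  refine MeasurableSpace.induction_on_inter (m := cylinderSigma N)
    (C := fun E _ => Q (prependWord i '' E) = S i * Q E * adjoint (S i)) rfl
    (cylinder_piSystem N) ?_ ?_ ?_ ?_ E hE
  · simp [hQ.2.1]
  · rintro _ ⟨f, hf, rfl⟩
    rw [prepend_cylinder, hQcyl _ (by simp), hQcyl _ hf]
    have : SWord S (i :: f) = S i * SWord S f := by simp [SWord]
    rw [this, ← star_eq_adjoint, ← star_eq_adjoint, ← star_eq_adjoint, star_mul]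
    simp only [mul_assoc]
  · intro t ht ih
    have htc := @MeasurableSet.compl _ _ (cylinderSigma N) ht
    have e1 := pvm_union hQ ht htc disjoint_compl_right
    rw [Set.union_compl_self, hQ.2.2.1] at e1
    have e2 := pvm_union hQ (meas_prepend_image i t ht) (meas_prepend_image i _ htc)
      ((Set.disjoint_image_iff hinj).2 disjoint_compl_right)
    rw [← Set.image_union, Set.union_compl_self, huniv, ih] at e2
    have e3 : Q tᶜ = 1 - Q t := by rw [e1]; abel
    have e4 : Q (prependWord i '' tᶜ) = S i * adjoint (S i) - S i * Q t * adjoint (S i) := by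
      rw [e2]; abel
    rw [e3, e4, mul_sub, sub_mul, mul_one]
  · intro F hd hm ih
    ext h
    have a1 := hQ.2.2.2 F hm hd (adjoint (S i) h)
    have a2 := a1.mapL (S i)
    have a3 := hQ.2.2.2 (fun n => prependWord i '' F n) (fun n => meas_prepend_image i _ (hm n))
      (fun a b hab => (Set.disjoint_image_iff hinj).2 (hd hab)) h
    rw [← Set.image_iUnion] at a3
    simp only [ih] at a3
    exact a3.unique a2

end PVM

/-- The projection-valued measure `Q_π` of a representation of the Cuntz algebra `𝒪_N`
satisfies: (1) `∑_i S_i Q_π(E) S_i^* = Q_π(σ⁻¹(E))`; (2) `S_i Q_π(E) = Q_π(iE) S_i`;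
(3) for `E ⊆ E_{(j)}`, `S_i^* Q_π(E) = δ_{ij} Q_π(σ(E)) S_i^*`. -/
theorem cuntz_projection_valued_measure_covariance
    {H : Type*} [NormedAddCommGroup H] [InnerProductSpace ℂ H] [CompleteSpace H]
    (N : ℕ) (hN : 2 ≤ N) (S : Fin N → H →L[ℂ] H)
    (hiso : ∀ i j, adjoint (S i) * S j = if i = j then 1 else 0)
    (hsum : ∑ i, S i * adjoint (S i) = 1)
    (Q : Set (ℕ → Fin N) → H →L[ℂ] H)
    (hQ : IsProjValuedMeasure Q)
    (hQcyl : ∀ f : List (Fin N), f ≠ [] → Q (cylinder f) = SWord S f * adjoint (SWord S f)) :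
    (∀ E : Set (ℕ → Fin N), @MeasurableSet _ (cylinderSigma N) E →
      ∑ i : Fin N, S i * Q E * adjoint (S i) = Q (shiftWord ⁻¹' E)) ∧
    (∀ (i : Fin N) (E : Set (ℕ → Fin N)), @MeasurableSet _ (cylinderSigma N) E →
      S i * Q E = Q (prependWord i '' E) * S i) ∧
    (∀ (j : Fin N) (E : Set (ℕ → Fin N)), @MeasurableSet _ (cylinderSigma N) E →
      E ⊆ cylinder [j] →
      ∀ i : Fin N, adjoint (S i) * Q E =
        if i = j then Q (shiftWord '' E) * adjoint (S i) else 0) := by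
  have hpre := pvm_prepend hQ hQcyl
  refine ⟨?_, ?_, ?_⟩
  · intro E hE
    have e : shiftWord ⁻¹' E = ⋃ i ∈ (Finset.univ : Finset (Fin N)), prependWord i '' E := by
      ext ω
      simp [prepend_image]
    rw [e, pvm_finset hQ _ _ (fun i => meas_prepend_image i E hE)]
    · simp only [hpre _ E hE]
    · intro a b hab
      simp only [Function.onFun, prepend_image]
      rw [Set.disjoint_left]
      rintro ω ⟨h1, -⟩ ⟨h2, -⟩
      exact hab (h1.symm.trans h2)
  · intro i E hE
    rw [hpre i E hE, mul_assoc, hiso]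
    simp
  · intro j E hE hsub i
    have h0 : ∀ ω ∈ E, ω 0 = j := fun ω h => ((mem_cylinder_cons j [] ω).1 (hsub h)).1
    have e : shiftWord '' E = prependWord j ⁻¹' E := by
      ext ω
      constructor
      · rintro ⟨η, h, rfl⟩
        rw [Set.mem_preimage, ← h0 η h, prepend_shift]
        exact h
      · intro h
        exact ⟨_, h, rfl⟩
    have hm : @MeasurableSet _ (cylinderSigma N) (shiftWord '' E) := by
      rw [e]
      exact meas_prepend j hE
    have e2 : prependWord j '' (shiftWord '' E) = E := by
      rw [e, Set.image_preimage_eq_inter_range, Set.inter_eq_left]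
      intro ω h
      exact ⟨shiftWord ω, by rw [← h0 ω h, prepend_shift]⟩
    have e3 := hpre j _ hm
    rw [e2] at e3
    rw [e3, ← mul_assoc, ← mul_assoc, hiso]
    split_ifs with h
    · rw [h, one_mul]
    · simp
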